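/- Let m ∈ (1,2] and β ∈ (1, 1+m]. If u ∈ {0,1}^ℕ starts with the letter 1, u ≠ 1 0̄ (i.e. u is not 1000⋯), and u ∈ U_β(m), then β ≥ max(f_u(m), g_u(m)). -/

import Mathlib

/-- `π_β(u)` for a binary sequence `u = u₁u₂⋯` (indexed from 0). -/
noncomputable def piB (β : ℝ) (u : ℕ → Bool) : ℝ :=
  ∑' k : ℕ, (if u k then (1 : ℝ) else 0) / β ^ (k + 1)

/-- `π_β(u)` for a real digit sequence. -/
noncomputable def piR (β : ℝ) (u : ℕ → ℝ) : ℝ := ∑' k : ℕ, u k / β ^ (k + 1)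

/-- A binary sequence viewed as a real digit sequence. -/
def bR (u : ℕ → Bool) : ℕ → ℝ := fun k => if u k then 1 else 0

/-- `U_β(A)`: sequences with digits in `A` whose `π_β`-value has no other expansion over `A`. -/
def Uset (β : ℝ) (A : Set ℝ) : Set (ℕ → ℝ) :=
  {u | (∀ k, u k ∈ A) ∧ ∀ v : ℕ → ℝ, (∀ k, v k ∈ A) → v ≠ u → piR β v ≠ piR β u}

/-- `𝓛(m) = inf {β > 1 : U_β(m) ∩ {0,1}^ℕ is uncountable}`. -/
noncomputable def Lval (m : ℝ) : ℝ :=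
  sInf {β : ℝ | 1 < β ∧ ¬ (Uset β {0, 1, m} ∩ {v | ∃ u : ℕ → Bool, v = bR u}).Countable}

/-- The shift orbit `O(u)` of an infinite binary word. -/
def orbit (u : ℕ → Bool) : Set (ℕ → Bool) := {v | ∃ k : ℕ, v = fun i => u (i + k)}

/-- Suffixes of `u` preceded by the letter `1`. -/
def orbit1 (u : ℕ → Bool) : Set (ℕ → Bool) :=
  {v | ∃ k : ℕ, u k = true ∧ v = fun i => u (i + k + 1)}

/-- Suffixes of `u` preceded by the letter `0`. -/
def orbit0 (u : ℕ → Bool) : Set (ℕ → Bool) :=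
  {v | ∃ k : ℕ, u k = false ∧ v = fun i => u (i + k + 1)}

open Classical in
/-- The lexicographic supremum of a set of binary sequences (greedy construction);
`⊥ = 0̄` for the empty set. -/
noncomputable def lexSupSeq (S : Set (ℕ → Bool)) : ℕ → Bool
  | n => decide (∃ u ∈ S, (∀ i, i < n → u i = lexSupSeq S i) ∧ u n = true)
  termination_by n => n

open Classical in
/-- The lexicographic infimum of a set of binary sequences (greedy construction);
`⊤ = 1̄` for the empty set. -/
noncomputable def lexInfSeq (S : Set (ℕ → Bool)) : ℕ → Bool
  | n => decide (¬ ∃ u ∈ S, (∀ i, i < n → u i = lexInfSeq S i) ∧ u n = false)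
  termination_by n => n

/-- `sup O(u)`, the lexicographically largest limit of suffixes of `u`. -/
noncomputable def supO (u : ℕ → Bool) : ℕ → Bool := lexSupSeq (orbit u)
/-- `inf O(u)`. -/
noncomputable def infO (u : ℕ → Bool) : ℕ → Bool := lexInfSeq (orbit u)
/-- `sup₀(u)`, the supremum of the suffixes preceded by `0`. -/
noncomputable def sup0 (u : ℕ → Bool) : ℕ → Bool := lexSupSeq (orbit0 u)
/-- `inf₁(u)`, the infimum of the suffixes preceded by `1`. -/
noncomputable def inf1 (u : ℕ → Bool) : ℕ → Bool := lexInfSeq (orbit1 u)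

/-- Strict lexicographic order on infinite binary words. -/
def lexLt (u v : ℕ → Bool) : Prop := ∃ n, (∀ i, i < n → u i = v i) ∧ u n < v n
/-- Lexicographic order on infinite binary words. -/
def lexLe (u v : ℕ → Bool) : Prop := lexLt u v ∨ u = v

/-- `f_u(m)`: the unique `β ≥ 1` with `β·π_β(sup O(u)) = m`. -/
noncomputable def fVal (u : ℕ → Bool) (m : ℝ) : ℝ :=
  sInf {β : ℝ | 1 ≤ β ∧ β * piB β (supO u) = m}

/-- `g_u(m)`: the unique `β > 1` with `(β-1)(1+π_β(inf O(u))) = m`. -/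
noncomputable def gVal (u : ℕ → Bool) (m : ℝ) : ℝ :=
  sInf {β : ℝ | 1 < β ∧ (β - 1) * (1 + piB β (infO u)) = m}

/-- `μ_u`: the unique `m ∈ (1,2]` with `f_u(m) = g_u(m)`. -/
noncomputable def muVal (u : ℕ → Bool) : ℝ :=
  sInf {m : ℝ | 1 < m ∧ m ≤ 2 ∧ fVal u m = gVal u m}

/-- `u` contains at least two ones. -/
def TwoOnes (u : ℕ → Bool) : Prop := ∃ k l, k < l ∧ u k = true ∧ u l = true

/-- The substitution `L : 0 ↦ 0, 1 ↦ 01` (with `0 = false`, `1 = true`). -/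
def Lsub : Bool → List Bool := fun b => if b then [false, true] else [false]
/-- The substitution `M : 0 ↦ 01, 1 ↦ 10`. -/
def Msub : Bool → List Bool := fun b => if b then [true, false] else [false, true]
/-- The substitution `R : 0 ↦ 01, 1 ↦ 1`. -/
def Rsub : Bool → List Bool := fun b => if b then [true] else [false, true]
/-- The identity substitution. -/
def idSub : Bool → List Bool := fun b => [b]
/-- Composition of substitutions: `compSub σ τ = σ ∘ τ` (apply `τ` first). -/
def compSub (σ τ : Bool → List Bool) : Bool → List Bool := fun b => (τ b).flatMap σ

/-- The monoid `{L,M,R}*` generated by the three substitutions. -/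
def LMRstar : Set (Bool → List Bool) :=
  {σ | ∃ l : List (Bool → List Bool),
    (∀ τ ∈ l, τ = Lsub ∨ τ = Msub ∨ τ = Rsub) ∧ σ = l.foldr compSub idSub}

/-- A substitution applied to an infinite word, `σ(u₁)σ(u₂)⋯`. -/
noncomputable def substApply (σ : Bool → List Bool) (u : ℕ → Bool) : ℕ → Bool := fun n =>
  let k := sSup {k : ℕ | (∑ i ∈ Finset.range k, (σ (u i)).length) ≤ n}
  (σ (u k)).getD (n - ∑ i ∈ Finset.range k, (σ (u i)).length) false

/-- `u` is a limit word of the sequence of substitutions `σseq`. -/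
def IsLimitWord (σseq : ℕ → Bool → List Bool) (u : ℕ → Bool) : Prop :=
  ∃ useq : ℕ → ℕ → Bool, useq 0 = u ∧ ∀ n, useq n = substApply (σseq n) (useq (n + 1))

/-- Primitivity of a sequence of substitutions in `{L,M,R}^ℕ`: no tail is constantly `L`
and no tail is constantly `R`. -/
def PrimitiveSeq (σseq : ℕ → Bool → List Bool) : Prop :=
  (¬ ∃ k, ∀ n, k ≤ n → σseq n = Lsub) ∧ ¬ ∃ k, ∀ n, k ≤ n → σseq n = Rsub

/-- `S_{L,M,R}`: the set of limit words of primitive sequences of substitutions. -/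
def Sset : Set (ℕ → Bool) :=
  {u | ∃ σseq : ℕ → Bool → List Bool,
    (∀ n, σseq n = Lsub ∨ σseq n = Msub ∨ σseq n = Rsub) ∧
    PrimitiveSeq σseq ∧ IsLimitWord σseq u}

/-- The word `1 0̄ = 1000⋯`. -/
def w10bar : ℕ → Bool := fun n => decide (n = 0)
/-- The word `0 1̄ = 0111⋯`. -/
def w01bar : ℕ → Bool := fun n => decide (n ≠ 0)
/-- The word `01 0̄ = 01000⋯`. -/
def w010bar : ℕ → Bool := fun n => decide (n = 1)
/-- The word `10 1̄ = 10111⋯`. -/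
def w101bar : ℕ → Bool := fun n => decide (n ≠ 1)
/-- The word `0̄`. -/
def w0bar : ℕ → Bool := fun _ => false
/-- The word `1̄`. -/
def w1bar : ℕ → Bool := fun _ => true

/-- Prepend a letter to an infinite word. -/
def consB (b : Bool) (u : ℕ → Bool) : ℕ → Bool := fun n =>
  match n with
  | 0 => b
  | Nat.succ k => u k

/-- Prepend a finite word to an infinite word. -/
def appendW (w : List Bool) (v : ℕ → Bool) : ℕ → Bool := fun n =>
  if n < w.length then w.getD n false else v (n - w.length)

/-! ### Expansions with bounded digits -/

theorem summable_div_pow_succ {β : ℝ} (hβ : 1 < β) {v : ℕ → ℝ} {C : ℝ}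
    (hv : ∀ k, v k ∈ Set.Icc 0 C) : Summable fun k => v k / β ^ (k + 1) := by
  have hβ0 : 0 < β := by linarith
  have hg : Summable fun k : ℕ => C * (β⁻¹ ^ k) :=
    (summable_geometric_of_lt_one (by positivity) (inv_lt_one_of_one_lt₀ hβ)).mul_left C
  refine Summable.of_nonneg_of_le (fun k => div_nonneg (hv k).1 (by positivity)) (fun k => ?_) hg
  rw [inv_pow, ← div_eq_mul_inv]
  exact div_le_div₀ ((hv k).1.trans (hv k).2) (hv k).2 (by positivity)
    (pow_le_pow_right₀ hβ.le (Nat.le_succ k))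

theorem piR_eq_head_add_tail {β : ℝ} (hβ : 1 < β) {v : ℕ → ℝ} {C : ℝ}
    (hv : ∀ k, v k ∈ Set.Icc 0 C) : piR β v = (v 0 + piR β (fun k => v (k + 1))) / β := by
  have hβ0 : β ≠ 0 := by linarith
  unfold piR
  rw [(summable_div_pow_succ hβ hv).tsum_eq_zero_add, add_div, ← tsum_div_const]
  congr 1
  · simp
  · refine tsum_congr fun k => ?_
    rw [pow_succ β (k + 1), div_div]

theorem piR_mono {β : ℝ} (hβ : 1 < β) {v w : ℕ → ℝ} {C D : ℝ} (hv : ∀ k, v k ∈ Set.Icc 0 C)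
    (hw : ∀ k, w k ∈ Set.Icc 0 D) (h : ∀ k, v k ≤ w k) : piR β v ≤ piR β w := by
  have hβ0 : 0 < β := by linarith
  refine (summable_div_pow_succ hβ hv).tsum_le_tsum (fun k => ?_) (summable_div_pow_succ hβ hw)
  have := h k
  gcongr

theorem piR_const {β : ℝ} (hβ : 1 < β) {C : ℝ} (hC : 0 ≤ C) :
    piR β (fun _ => C) = C / (β - 1) := by
  have h := piR_eq_head_add_tail hβ (v := fun _ => C) (C := C) (fun _ => ⟨hC, le_rfl⟩)
  rw [eq_div_iff (by linarith)] at h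
  rw [eq_div_iff (by linarith)]
  linarith

theorem piR_mem_Icc {β : ℝ} (hβ : 1 < β) {v : ℕ → ℝ} {C : ℝ} (hv : ∀ k, v k ∈ Set.Icc 0 C) :
    piR β v ∈ Set.Icc 0 (C / (β - 1)) := by
  have hC : 0 ≤ C := (hv 0).1.trans (hv 0).2
  have hβ0 : 0 < β := by linarith
  refine ⟨tsum_nonneg fun k => div_nonneg (hv k).1 (by positivity), ?_⟩
  rw [← piR_const hβ hC]
  exact piR_mono hβ hv (fun _ => ⟨hC, le_rfl⟩) fun k => (hv k).2

theorem abs_piR_sub_le {β : ℝ} (hβ : 1 < β) {C : ℝ} (n : ℕ) {v w : ℕ → ℝ}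
    (hv : ∀ k, v k ∈ Set.Icc 0 C) (hw : ∀ k, w k ∈ Set.Icc 0 C) (h : ∀ k < n, v k = w k) :
    |piR β v - piR β w| ≤ C / (β - 1) / β ^ n := by
  have hβ0 : 0 < β := by linarith
  induction n generalizing v w with
  | zero =>
    have h1 := piR_mem_Icc hβ hv
    have h2 := piR_mem_Icc hβ hw
    rw [pow_zero, div_one, abs_le]
    exact ⟨by linarith [h1.1, h2.2], by linarith [h1.2, h2.1]⟩
  | succ n ih =>
    have := ih (fun k => hv (k + 1)) (fun k => hw (k + 1)) (fun k hk => h (k + 1) (by omega))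
    rw [piR_eq_head_add_tail hβ hv, piR_eq_head_add_tail hβ hw, h 0 (by omega), ← sub_div,
      add_sub_add_left_eq_sub, abs_div, abs_of_pos hβ0, pow_succ, ← div_div]
    gcongr

/-- `π_β` is strictly decreasing in `β` for a nonzero sequence of nonnegative digits. -/
theorem piR_strictAnti {β γ : ℝ} (hβ : 1 < β) (hγ : β < γ) {v : ℕ → ℝ} {C : ℝ}
    (hv : ∀ k, v k ∈ Set.Icc 0 C) {l : ℕ} (hl : 0 < v l) : piR γ v < piR β v := by
  have hβ0 : 0 < β := by linarith
  refine Summable.tsum_lt_tsum (i := l) (fun k => ?_) ?_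
    (summable_div_pow_succ (hβ.trans hγ) hv) (summable_div_pow_succ hβ hv)
  · have := (hv k).1
    gcongr
  · gcongr

/-! ### Digits in `{0, 1, m}` -/

theorem mem_Icc_of_mem_digits {m x : ℝ} (hm : m ∈ Set.Ioc (1 : ℝ) 2)
    (hx : x ∈ ({0, 1, m} : Set ℝ)) : x ∈ Set.Icc 0 m := by
  obtain ⟨h1, h2⟩ := hm
  rcases hx with rfl | rfl | rfl <;> constructor <;> linarith

/-- Every point of `[0, m/(β-1)]` has an expansion over `{0, 1, m}`. -/
theorem exists_expansion {m β : ℝ} (hm : m ∈ Set.Ioc (1 : ℝ) 2) (hβ : β ∈ Set.Ioc (1 : ℝ) (1 + m))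
    {x : ℝ} (hx : x ∈ Set.Icc 0 (m / (β - 1))) :
    ∃ v : ℕ → ℝ, (∀ k, v k ∈ ({0, 1, m} : Set ℝ)) ∧ piR β v = x := by
  obtain ⟨hm1, hm2⟩ := hm
  obtain ⟨hβ1, hβ2⟩ := hβ
  have hβ0 : 0 < β := by linarith
  set T := m / (β - 1) with hT
  have hTm : T * β = m + T := by
    rw [hT]
    field_simp [show β - 1 ≠ 0 by linarith]
    ring
  have hT1 : 1 ≤ T := by
    rw [hT, le_div_iff₀ (by linarith)]
    linarith
  have step : ∀ y : Set.Icc 0 T, ∃ d ∈ ({0, 1, m} : Set ℝ), β * y - d ∈ Set.Icc 0 T := by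
    rintro ⟨y, hy0, hy1⟩
    have h1 : 0 ≤ β * y := by positivity
    have h2 : β * y ≤ m + T := by nlinarith
    rcases le_or_gt (β * y) T with h | h
    · exact ⟨0, by simp, by simpa using ⟨h1, h⟩⟩
    rcases le_or_gt (β * y) (1 + T) with h' | h'
    · exact ⟨1, by simp, by constructor <;> simp only <;> linarith⟩
    · exact ⟨m, by simp, by constructor <;> simp only <;> linarith⟩
  choose d hd hr using step
  let r : ℕ → Set.Icc 0 T := fun n => Nat.rec (motive := fun _ => Set.Icc 0 T) ⟨x, hx⟩
    (fun _ y => ⟨β * y - d y, hr y⟩) n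
  have hr_succ : ∀ n, (r (n + 1)).1 = β * (r n).1 - d (r n) := fun _ => rfl
  have hsum : ∀ n, ∑ k ∈ Finset.range n, d (r k) / β ^ (k + 1) = x - r n / β ^ n := by
    intro n
    induction n with
    | zero => simp [r]
    | succ n ih =>
      rw [Finset.sum_range_succ, ih, hr_succ]
      field_simp
      ring
  have hlim : Filter.Tendsto (fun n => (r n : ℝ) / β ^ n) Filter.atTop (nhds 0) := by
    have h0 : Filter.Tendsto (fun n : ℕ => T / β ^ n) Filter.atTop (nhds 0) :=
      Filter.Tendsto.const_div_atTop (tendsto_pow_atTop_atTop_of_one_lt hβ1) T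
    refine squeeze_zero (fun n => div_nonneg (r n).2.1 (by positivity)) (fun n => ?_) h0
    have := (r n).2.2
    gcongr
  refine ⟨fun k => d (r k), fun k => hd _, ?_⟩
  refine HasSum.tsum_eq ?_
  rw [hasSum_iff_tendsto_nat_of_nonneg
    fun k => div_nonneg (mem_Icc_of_mem_digits ⟨hm1, hm2⟩ (hd _)).1 (by positivity)]
  simp only [hsum]
  simpa using hlim.const_sub x

theorem shift_mem_Uset {m β : ℝ} (hm : m ∈ Set.Ioc (1 : ℝ) 2) (hβ : 1 < β) {u : ℕ → ℝ}
    (hu : u ∈ Uset β {0, 1, m}) : (fun k => u (k + 1)) ∈ Uset β {0, 1, m} := by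
  refine ⟨fun k => hu.1 _, fun v hv hne heq => ?_⟩
  let w : ℕ → ℝ := fun n => n.casesOn (u 0) v
  have hw : ∀ k, w k ∈ ({0, 1, m} : Set ℝ) := fun k => by
    cases k
    · exact hu.1 0
    · exact hv _
  refine hu.2 w hw (fun h => hne ?_) ?_
  · funext k
    exact congrFun h (k + 1)
  · rw [piR_eq_head_add_tail hβ fun k => mem_Icc_of_mem_digits hm (hw k),
      piR_eq_head_add_tail hβ fun k => mem_Icc_of_mem_digits hm (hu.1 k), ← heq]
    rfl

/-- A sequence with a unique expansion admits no other choice of first digit. -/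
theorem head_add_tail_sub_notMem {m β : ℝ} (hm : m ∈ Set.Ioc (1 : ℝ) 2)
    (hβ : β ∈ Set.Ioc (1 : ℝ) (1 + m)) {u : ℕ → ℝ} (hu : u ∈ Uset β {0, 1, m}) {d : ℝ}
    (hd : d ∈ ({0, 1, m} : Set ℝ)) (hne : d ≠ u 0) :
    u 0 + piR β (fun k => u (k + 1)) - d ∉ Set.Icc 0 (m / (β - 1)) := by
  intro hx
  obtain ⟨v, hv, hvx⟩ := exists_expansion hm hβ hx
  let w : ℕ → ℝ := fun n => n.casesOn d v
  have hw : ∀ k, w k ∈ ({0, 1, m} : Set ℝ) := fun k => by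
    cases k
    · exact hd
    · exact hv _
  refine hu.2 w hw (fun h => hne (congrFun h 0)) ?_
  rw [piR_eq_head_add_tail hβ.1 fun k => mem_Icc_of_mem_digits hm (hw k),
    piR_eq_head_add_tail hβ.1 fun k => mem_Icc_of_mem_digits hm (hu.1 k)]
  change (d + piR β v) / β = _
  rw [hvx]
  congr 1
  ring

/-! ### Binary sequences -/

theorem bR_mem_Icc (u : ℕ → Bool) (k : ℕ) : bR u k ∈ Set.Icc (0 : ℝ) 1 := by
  unfold bR
  split_ifs <;> simp

theorem piB_eq_piR (β : ℝ) (u : ℕ → Bool) : piB β u = piR β (bR u) := rfl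

theorem piB_nonneg {β : ℝ} (hβ : 1 < β) (u : ℕ → Bool) : 0 ≤ piB β u :=
  (piR_mem_Icc hβ (bR_mem_Icc u)).1

theorem mul_piB {β : ℝ} (hβ : 1 < β) (u : ℕ → Bool) :
    β * piB β u = bR u 0 + piB β (fun k => u (k + 1)) := by
  rw [piB_eq_piR, piR_eq_head_add_tail hβ (bR_mem_Icc u)]
  exact mul_div_cancel₀ _ (by linarith)

theorem shift_bR_mem_Uset {m β : ℝ} (hm : m ∈ Set.Ioc (1 : ℝ) 2) (hβ : 1 < β) {u : ℕ → Bool}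
    (hu : bR u ∈ Uset β {0, 1, m}) (k : ℕ) : bR (fun i => u (i + k)) ∈ Uset β {0, 1, m} := by
  induction k with
  | zero => exact hu
  | succ k ih =>
    convert shift_mem_Uset hm hβ ih using 1
    funext i
    simp only [bR, add_right_comm, add_assoc]

/-- If a prefix of length `n` of `w` is a prefix of some element of `S`, for all `n`, and `π_β`
takes values in a closed set on `S`, then so it does at `w`. -/
theorem piB_mem_of_forall_prefix {β : ℝ} (hβ : 1 < β) {S : Set (ℕ → Bool)} {w : ℕ → Bool}
    (hw : ∀ n, ∃ v ∈ S, ∀ i < n, v i = w i) {K : Set ℝ} (hK : IsClosed K)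
    (h : ∀ v ∈ S, piB β v ∈ K) : piB β w ∈ K := by
  choose v hvS hv using hw
  refine hK.mem_of_tendsto (f := fun n => piB β (v n)) (b := Filter.atTop) ?_
    (Filter.Eventually.of_forall fun n => h _ (hvS n))
  rw [tendsto_iff_dist_tendsto_zero]
  have h0 : Filter.Tendsto (fun n : ℕ => 1 / (β - 1) / β ^ n) Filter.atTop (nhds 0) :=
    Filter.Tendsto.const_div_atTop (tendsto_pow_atTop_atTop_of_one_lt hβ) _
  refine squeeze_zero (fun n => dist_nonneg) (fun n => ?_) h0
  exact abs_piR_sub_le hβ n (bR_mem_Icc _) (bR_mem_Icc _) fun k hk => congrArg (fun b : Bool => if b then (1 : ℝ) else 0) (hv n k hk)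

open Classical in
theorem lexSupSeq_eq_true {S : Set (ℕ → Bool)} {u : ℕ → Bool} (hu : u ∈ S) {n : ℕ}
    (h : ∀ i < n, u i = lexSupSeq S i) (hn : u n = true) : lexSupSeq S n = true := by
  rw [lexSupSeq]
  exact decide_eq_true ⟨u, hu, h, hn⟩

open Classical in
theorem exists_prefix_lexSupSeq {S : Set (ℕ → Bool)} (hS : S.Nonempty) (n : ℕ) :
    ∃ v ∈ S, ∀ i < n, v i = lexSupSeq S i := by
  induction n with
  | zero => exact ⟨hS.some, hS.some_mem, by simp⟩
  | succ n ih =>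
    obtain ⟨v, hv, hvi⟩ := ih
    cases hn : lexSupSeq S n with
    | true =>
      have hn' := hn
      rw [lexSupSeq, decide_eq_true_eq] at hn'
      obtain ⟨w, hw, hwi, hwn⟩ := hn'
      exact ⟨w, hw, Nat.forall_lt_succ_right.2 ⟨hwi, hwn.trans hn.symm⟩⟩
    | false =>
      refine ⟨v, hv, Nat.forall_lt_succ_right.2 ⟨hvi, ?_⟩⟩
      by_contra hne
      rw [hn, Bool.not_eq_false] at hne
      simp [lexSupSeq_eq_true hv hvi hne] at hn

open Classical in
theorem exists_prefix_lexInfSeq {S : Set (ℕ → Bool)} (hS : S.Nonempty) (n : ℕ) :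
    ∃ v ∈ S, ∀ i < n, v i = lexInfSeq S i := by
  induction n with
  | zero => exact ⟨hS.some, hS.some_mem, by simp⟩
  | succ n ih =>
    obtain ⟨v, hv, hvi⟩ := ih
    have hn := lexInfSeq.eq_1 S n
    by_cases h : ∃ u ∈ S, (∀ i, i < n → u i = lexInfSeq S i) ∧ u n = false
    · obtain ⟨w, hw, hwi, hwn⟩ := h
      refine ⟨w, hw, Nat.forall_lt_succ_right.2 ⟨hwi, ?_⟩⟩
      rw [hwn, hn]
      exact (decide_eq_false (not_not.2 ⟨w, hw, hwi, hwn⟩)).symm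
    · refine ⟨v, hv, Nat.forall_lt_succ_right.2 ⟨hvi, ?_⟩⟩
      rw [hn, decide_eq_true h]
      by_contra hne
      exact h ⟨v, hv, hvi, by simpa using hne⟩

theorem orbit_nonempty (u : ℕ → Bool) : (orbit u).Nonempty := ⟨u, 0, rfl⟩

theorem supO_zero {u : ℕ → Bool} (h1 : u 0 = true) : supO u 0 = true :=
  lexSupSeq_eq_true (S := orbit u) ⟨0, rfl⟩ (by simp) h1

theorem exists_supO_succ_eq_true {u : ℕ → Bool} (h1 : u 0 = true) (hne : u ≠ w10bar) :
    ∃ l, supO u (l + 1) = true := by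
  by_contra! hc
  have key : ∀ n, u n = supO u n := by
    intro n
    induction n using Nat.strong_induction_on with
    | _ n ih =>
      cases n with
      | zero => rw [h1, supO_zero h1]
      | succ n =>
        cases hun : u (n + 1) with
        | true => exact absurd (lexSupSeq_eq_true (S := orbit u) ⟨0, rfl⟩ ih hun) (hc n)
        | false => simpa using (hc n).symm
  refine hne (funext fun n => ?_)
  rw [key]
  cases n with
  | zero => simp [supO_zero h1, w10bar]
  | succ n => simpa [w10bar] using hc n

/-! ### The bounds given by `f_u` and `g_u` -/

theorem fVal_le {m β : ℝ} (hβ : 1 < β) {u : ℕ → Bool} (h1 : u 0 = true) (hne : u ≠ w10bar)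
    (h : β * piB β (supO u) ≤ m) : fVal u m ≤ β := by
  unfold fVal
  rcases Set.eq_empty_or_nonempty {b : ℝ | 1 ≤ b ∧ b * piB b (supO u) = m} with he | ⟨b, hb⟩
  · rw [he, Real.sInf_empty]
    linarith
  refine (csInf_le ⟨1, fun c hc => hc.1⟩ hb).trans (le_of_not_gt fun hlt => ?_)
  obtain ⟨l, hl⟩ := exists_supO_succ_eq_true h1 hne
  have := piR_strictAnti hβ hlt (bR_mem_Icc fun k => supO u (k + 1)) (l := l) (by simp [bR, hl])
  have hb2 := hb.2
  rw [mul_piB (hβ.trans hlt), piB_eq_piR] at hb2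
  rw [mul_piB hβ, piB_eq_piR] at h
  linarith

theorem gVal_le {m β : ℝ} (hβ : 1 < β) (hm : 1 < m) {u : ℕ → Bool}
    (h : m / (β - 1) - 1 ≤ piB β (infO u)) : gVal u m ≤ β := by
  unfold gVal
  rcases Set.eq_empty_or_nonempty {b : ℝ | 1 < b ∧ (b - 1) * (1 + piB b (infO u)) = m}
    with he | ⟨b, hb⟩
  · rw [he, Real.sInf_empty]
    linarith
  refine (csInf_le ⟨1, fun c hc => hc.1.le⟩ hb).trans (le_of_not_gt fun hlt => ?_)
  have hcomp : ∀ k, m - bR (infO u) k ∈ Set.Icc 0 m := fun k => by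
    obtain ⟨h0, h1⟩ := bR_mem_Icc (infO u) k
    constructor <;> linarith
  have hsub : ∀ c : ℝ, 1 < c →
      piR c (fun k => m - bR (infO u) k) = m / (c - 1) - piB c (infO u) := fun c hc => by
    have hs := (summable_div_pow_succ hc (v := fun _ => m) (C := m)
      fun _ => ⟨by linarith, le_rfl⟩).tsum_sub (summable_div_pow_succ hc (bR_mem_Icc (infO u)))
    rw [← piR_const hc (by linarith), piB_eq_piR]
    simp only [piR, sub_div]
    exact hs
  have hlt' := piR_strictAnti hβ hlt hcomp (l := 0) (by
    have := (bR_mem_Icc (infO u) 0).2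
    linarith)
  rw [hsub β hβ, hsub b hb.1] at hlt'
  have : 1 + piB b (infO u) = m / (b - 1) := by
    rw [eq_div_iff (by linarith [hb.1]), mul_comm]
    exact hb.2
  linarith

/-- If `u` starts with `1`, `u ≠ 1 0̄`, and `u ∈ U_β(m)`, then `β ≥ max (f_u(m), g_u(m))`. -/
theorem mem_U_implies_ge_max (m β : ℝ) (hm : m ∈ Set.Ioc (1 : ℝ) 2)
    (hβ : β ∈ Set.Ioc (1 : ℝ) (1 + m)) (u : ℕ → Bool) (h1 : u 0 = true) (hne : u ≠ w10bar)
    (hU : bR u ∈ Uset β {0, 1, m}) :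
    max (fVal u m) (gVal u m) ≤ β := by
  have hβ1 := hβ.1
  have hβm := hβ.2
  obtain ⟨hm1, hm2⟩ := hm
  set T := m / (β - 1) with hT
  have hTβ : T * (β - 1) = m := div_mul_cancel₀ _ (by linarith)
  have hT1 : 1 ≤ T := by
    rw [hT, le_div_iff₀ (by linarith)]
    linarith
  let t : ℕ → ℝ := fun k => piB β fun i => u (i + k)
  have ht0 : ∀ k, 0 ≤ t k := fun k => piB_nonneg hβ1 _
  have hrec : ∀ k, β * t k = bR u k + t (k + 1) := fun k => by
    have h := mul_piB hβ1 fun i => u (i + k)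
    simpa only [t, bR, zero_add, add_right_comm, add_assoc] using h
  have hnot : ∀ k, ∀ d ∈ ({0, 1, m} : Set ℝ), d ≠ bR u k →
      β * t k - d ∉ Set.Icc 0 T := fun k d hd hne => by
    have h := head_add_tail_sub_notMem ⟨hm1, hm2⟩ hβ
      (shift_bR_mem_Uset ⟨hm1, hm2⟩ hβ1 hU k) hd (by simpa [bR] using hne)
    have h' := mul_piB hβ1 fun i => u (i + k)
    change β * piB β (fun i => u (i + k)) - d ∉ _
    rw [h']
    exact h
  have htT : ∀ k, t k ≤ T := fun k =>
    (piR_mem_Icc hβ1 (bR_mem_Icc _)).2.trans (by rw [hT]; gcongr)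
  have hone : ∀ k, u k = true → t (k + 1) < m - 1 ∧ T - 1 < t (k + 1) := fun k hk => by
    have hb : bR u k = 1 := by simp [bR, hk]
    have h0 := hnot k 0 (by simp) (by simp [hb])
    have h2 := hnot k m (by simp) (by rw [hb]; exact hm1.ne')
    rw [hrec, hb] at h0 h2
    have := ht0 (k + 1)
    have := htT (k + 1)
    constructor
    · by_contra! hc
      exact h2 ⟨by linarith, by linarith⟩
    · by_contra! hc
      exact h0 ⟨by linarith, by linarith⟩
  have hzero : ∀ k, u k = false → t (k + 1) < 1 := fun k hk => by
    have hb : bR u k = 0 := by simp [bR, hk]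
    have h2 := hnot k 1 (by simp) (by simp [hb])
    rw [hrec, hb] at h2
    have := htT (k + 1)
    by_contra! hc
    exact h2 ⟨by linarith, by linarith⟩
  have hupper : ∀ k, β * t k ≤ m := fun k => by
    rw [hrec]
    cases hk : u k with
    | true => simpa [bR, hk] using (by linarith [(hone k hk).1] : 1 + t (k + 1) ≤ m)
    | false => simpa [bR, hk] using (by linarith [hzero k hk] : t (k + 1) ≤ m)
  have hβ2 : 2 < β := by
    have h := hone 0 h1
    nlinarith
  have hlower : ∀ k, T - 1 ≤ t k := fun k => by
    induction k with
    | zero =>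
      have h := (hone 0 h1).2
      have h' := hrec 0
      rw [show bR u 0 = 1 by simp [bR, h1]] at h'
      nlinarith
    | succ k ih =>
      cases hk : u k with
      | true => exact (hone k hk).2.le
      | false =>
        have h' := hrec k
        rw [show bR u k = 0 by simp [bR, hk]] at h'
        nlinarith [ht0 k]
  refine max_le (fVal_le hβ1 h1 hne ?_) (gVal_le hβ1 hm1 ?_)
  · rw [mul_comm, ← le_div_iff₀ (by linarith)]
    refine piB_mem_of_forall_prefix hβ1 (exists_prefix_lexSupSeq (orbit_nonempty u))
      (isClosed_Iic (a := m / β)) ?_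
    rintro _ ⟨k, rfl⟩
    rw [Set.mem_Iic, le_div_iff₀ (by linarith), mul_comm]
    exact hupper k
  · refine piB_mem_of_forall_prefix hβ1 (exists_prefix_lexInfSeq (orbit_nonempty u))
      (isClosed_Ici (a := T - 1)) ?_
    rintro _ ⟨k, rfl⟩
    exact hlower k
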